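/- For every dimension d ≥ 1 and every ν > 0 there exist constants c > 0 and ε₀ > 0, depending only on d and ν, such that for every ε ∈ (0, ε₀) there exist an integer J ≥ 2^{c · ε^{−d/ν}} and functions f₁, …, f_J ∈ C_p^ν([-1,1]^d) satisfying ‖f_j‖_{C^ν} ≤ 1 for all j and sup_{x ∈ [-1,1]^d} |f_j(x) − f_{j'}(x)| ≥ ε for all j ≠ j'. -/

import Mathlib

open Real MeasureTheory Set

noncomputable section

/-- `ν* = ⌈ν - 1⌉` as a natural number. -/
def nuStar (ν : ℝ) : ℕ := (⌈ν - 1⌉).toNat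

/-- Partial derivative in the `j`-th coordinate direction. -/
def pderiv {d : ℕ} (j : Fin d) (f : (Fin d → ℝ) → ℝ) : (Fin d → ℝ) → ℝ :=
  fun x => fderiv ℝ f x (Pi.single j 1)

/-- The iterated partial derivative `D^α` associated to the multi-index `α`. -/
def mDeriv {d : ℕ} (α : Fin d → ℕ) (f : (Fin d → ℝ) → ℝ) : (Fin d → ℝ) → ℝ :=
  (List.finRange d).foldr (fun j g => (pderiv j)^[α j] g) f

/-- A multivariate trigonometric polynomial of degree at most `N` on `[-1,1]^d`: a real
linear combination of `x ↦ cos (π k·x)` and `x ↦ sin (π k·x)` over `k ∈ ℤ^d`, `‖k‖₁ ≤ N`. -/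
def IsTrigPolyD (d N : ℕ) (T : (Fin d → ℝ) → ℝ) : Prop :=
  ∃ S : Finset (Fin d → ℤ), ∃ a b : (Fin d → ℤ) → ℝ,
    (∀ k ∈ S, (∑ j, (k j).natAbs) ≤ N) ∧
    ∀ x : Fin d → ℝ, T x = ∑ k ∈ S,
      (a k * Real.cos (π * ∑ j, (k j : ℝ) * x j) + b k * Real.sin (π * ∑ j, (k j : ℝ) * x j))

/-- The box `[-1,1]^d`. -/
def box (d : ℕ) : Set (Fin d → ℝ) := Set.univ.pi fun _ => Set.Icc (-1 : ℝ) 1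

/-- Sup norm over `[-1,1]^d`. -/
def supBox {d : ℕ} (g : (Fin d → ℝ) → ℝ) : ℝ := ⨆ x : box d, |g x|

/-- The Hölder condition of order `ν - ν*` (in the `ℓ^∞` norm) for the derivatives of order
`ν*`, with constant `L`. -/
def HolderCondD (ν : ℝ) {d : ℕ} (f : (Fin d → ℝ) → ℝ) (L : ℝ) : Prop :=
  ∀ α : Fin d → ℕ, (∑ j, α j) = nuStar ν → ∀ x y : Fin d → ℝ,
    |mDeriv α f x - mDeriv α f y| ≤ L * ‖x - y‖ ^ (ν - (nuStar ν : ℝ))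

/-- Membership in `C_p^ν([-1,1]^d)`: 2-periodic in each coordinate, `ν*`-times continuously
differentiable, and the order-`ν*` derivatives are `(ν - ν*)`-Hölder. -/
def MemCpD (ν : ℝ) {d : ℕ} (f : (Fin d → ℝ) → ℝ) : Prop :=
  (∀ (x : Fin d → ℝ) (j : Fin d), f (x + Pi.single j 2) = f x) ∧
  ContDiff ℝ (nuStar ν) f ∧ ∃ L : ℝ, 0 ≤ L ∧ HolderCondD ν f L

/-- `L_ν(f)`: the least Hölder constant. -/
def holderConstD (ν : ℝ) {d : ℕ} (f : (Fin d → ℝ) → ℝ) : ℝ :=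
  sInf {L : ℝ | 0 ≤ L ∧ HolderCondD ν f L}

/-- The `C^ν` norm of a periodic function: max of the sup norms (over `[-1,1]^d`) of the
derivatives `D^α f` for `|α| ≤ ν*`, and of `L_ν(f)`. -/
def CnuNormD (ν : ℝ) {d : ℕ} (f : (Fin d → ℝ) → ℝ) : ℝ :=
  max (sSup {c : ℝ | ∃ α : Fin d → ℕ, (∑ j, α j) ≤ nuStar ν ∧ c = supBox (mDeriv α f)})
    (holderConstD ν f)

/-- The function equal to `χ k * φ (y - k)` on the cell `[k, k + 1)`, `k ∈ ℤ`. -/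
def cellLift (χ : ℤ → ℝ) (φ : ℝ → ℝ) (y : ℝ) : ℝ := χ ⌊y⌋ * φ (Int.fract y)

theorem cellLift_eventuallyEq {φ : ℝ → ℝ} (hφ : tsupport φ ⊆ Icc (1 / 4) (3 / 4)) (χ : ℤ → ℝ)
    (y : ℝ) : cellLift χ φ =ᶠ[nhds y] fun t => χ ⌊y⌋ * φ (t - ⌊y⌋) := by
  have hz : ∀ t, t ∉ Icc (1 / 4 : ℝ) (3 / 4) → φ t = 0 := fun t ht =>
    image_eq_zero_of_notMem_tsupport fun h => ht (hφ h)
  have hy := Int.floor_le y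
  have hy' := Int.lt_floor_add_one y
  filter_upwards [Ioo_mem_nhds (show (⌊y⌋ : ℝ) - 1 / 4 < y by linarith) hy'] with t ht
  by_cases h : (⌊y⌋ : ℝ) ≤ t
  · have : ⌊t⌋ = ⌊y⌋ := Int.floor_eq_iff.2 ⟨h, ht.2⟩
    simp only [cellLift, Int.fract, this]
  · have : ⌊t⌋ = ⌊y⌋ - 1 := by
      refine Int.floor_eq_iff.2 ⟨?_, ?_⟩ <;> push_cast <;> linarith [ht.1]
    simp only [cellLift, Int.fract, this]
    rw [hz (t - ⌊y⌋), hz, mul_zero, mul_zero]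
    · push_cast
      exact fun h' => by linarith [h'.2, ht.1]
    · exact fun h' => by linarith [h'.1]

theorem contDiff_cellLift {φ : ℝ → ℝ} {r : WithTop ℕ∞} (hs : ContDiff ℝ r φ)
    (hφ : tsupport φ ⊆ Icc (1 / 4) (3 / 4)) (χ : ℤ → ℝ) : ContDiff ℝ r (cellLift χ φ) := by
  refine contDiff_iff_contDiffAt.2 fun y => ContDiffAt.congr_of_eventuallyEq ?_
    (cellLift_eventuallyEq hφ χ y)
  exact (contDiff_const.mul (hs.comp (contDiff_id.sub contDiff_const))).contDiffAt

theorem hasDerivAt_cellLift {φ : ℝ → ℝ} (hs : Differentiable ℝ φ)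
    (hφ : tsupport φ ⊆ Icc (1 / 4) (3 / 4)) (χ : ℤ → ℝ) (y : ℝ) :
    HasDerivAt (cellLift χ φ) (cellLift χ (deriv φ) y) y := by
  refine HasDerivAt.congr_of_eventuallyEq ?_ (cellLift_eventuallyEq hφ χ y)
  exact ((hs (y - ⌊y⌋)).hasDerivAt.comp_sub_const y _).const_mul _

theorem pderiv_sum_prod {ι : Type*} [Fintype ι] {d : ℕ} (σ : ι → ℝ) (g g' : ι → Fin d → ℝ → ℝ)
    (hg : ∀ z i t, HasDerivAt (g z i) (g' z i t) t) (j : Fin d) :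
    pderiv j (fun x => ∑ z, σ z * ∏ i, g z i (x i)) =
      fun x => ∑ z, σ z * ∏ i, (if i = j then g' z i else g z i) (x i) := by
  classical
  funext x
  have h : HasFDerivAt (fun x : Fin d → ℝ => ∑ z, σ z * ∏ i, g z i (x i)) _ x :=
    HasFDerivAt.fun_sum fun z _ => (HasFDerivAt.finsetProd fun i _ =>
      (hg z i (x i)).comp_hasFDerivAt x
        (ContinuousLinearMap.proj (R := ℝ) (φ := fun _ : Fin d => ℝ) i).hasFDerivAt).const_mul (σ z)
  rw [pderiv, h.fderiv]
  simp only [_root_.sum_apply, _root_.smul_apply,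
    ContinuousLinearMap.proj_apply, smul_eq_mul, Function.comp]
  refine Finset.sum_congr rfl fun z _ => congrArg _ ?_
  rw [Finset.sum_eq_single j (fun i _ hi => by simp [hi]) (by simp),
    ← Finset.mul_prod_erase _ _ (Finset.mem_univ j), mul_comm]
  simp only [Pi.single_eq_same, mul_one, if_true]
  refine congrArg _ (Finset.prod_congr rfl fun i hi => ?_)
  rw [if_neg (Finset.ne_of_mem_erase hi)]

/-- The indicator of the residue class of `m` modulo `n`. -/
def residueInd (n : ℕ) (m : Fin n) (k : ℤ) : ℝ := if k % n = m then 1 else 0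

theorem sum_residueInd_le_one (n : ℕ) (k : ℤ) : ∑ m, residueInd n m k ≤ 1 := by
  by_cases h : ∃ m : Fin n, k % n = m
  · obtain ⟨m, hm⟩ := h
    rw [Finset.sum_eq_single m]
    · simp [residueInd, hm]
    · intro b _ hb
      rw [residueInd, if_neg]
      rw [hm]
      exact fun h => hb (Fin.ext (by exact_mod_cast h.symm))
    · simp
  · push Not at h
    simp [residueInd, h]

/-- The `1`-periodic bump sum with coefficients `σ` on the grid of mesh `1 / n`, built from the
profile `φ`, after differentiating `β j` times in the `j`-th coordinate. -/
def gridSum {d : ℕ} (n : ℕ) (φ : ℝ → ℝ) (σ : (Fin d → Fin n) → ℝ) (β : Fin d → ℕ)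
    (x : Fin d → ℝ) : ℝ :=
  ∑ z, σ z * ∏ i, ((n : ℝ) ^ β i * cellLift (residueInd n (z i)) (deriv^[β i] φ) (n * x i))

theorem tsupport_iterate_deriv_subset (φ : ℝ → ℝ) (m : ℕ) :
    tsupport (deriv^[m] φ) ⊆ tsupport φ := by
  induction m with
  | zero => rfl
  | succ m ih =>
    rw [Function.iterate_succ_apply']
    exact tsupport_deriv_subset.trans ih

theorem exists_iterate_deriv_bound {φ : ℝ → ℝ} (hs : ContDiff ℝ (⊤ : ℕ∞) φ)
    (hc : HasCompactSupport φ) (N : ℕ) :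
    ∃ M : ℝ, 1 ≤ M ∧ ∀ m ≤ N, ∀ t, |deriv^[m] φ t| ≤ M := by
  have h : ∀ m, ∃ C, ∀ t, ‖deriv^[m] φ t‖ ≤ C := fun m =>
    (hc.mono' (subset_tsupport _ |>.trans
      (tsupport_iterate_deriv_subset φ m))).exists_bound_of_continuous
      (hs.iterate_deriv m).continuous
  choose C hC using h
  refine ⟨1 + ∑ m ∈ Finset.range (N + 1), |C m|, ?_, fun m hm t => ?_⟩
  · linarith [Finset.sum_nonneg fun m (_ : m ∈ Finset.range (N + 1)) => abs_nonneg (C m)]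
  · have := Finset.single_le_sum (fun m _ => abs_nonneg (C m))
      (Finset.mem_range.2 (Nat.lt_succ_of_le hm))
    have h2 := hC m t
    rw [Real.norm_eq_abs] at h2
    linarith [le_abs_self (C m)]

section gridSum

variable {d n : ℕ} {φ : ℝ → ℝ}

theorem contDiff_gridSum (hs : ContDiff ℝ (⊤ : ℕ∞) φ) (hφ : tsupport φ ⊆ Icc (1 / 4) (3 / 4))
    (σ : (Fin d → Fin n) → ℝ) (β : Fin d → ℕ) :
    ContDiff ℝ (⊤ : ℕ∞) (gridSum n φ σ β) := by
  refine ContDiff.sum fun z _ => contDiff_const.mul (contDiff_prod fun i _ =>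
    contDiff_const.mul ?_)
  exact (contDiff_cellLift (hs.iterate_deriv _)
    ((tsupport_iterate_deriv_subset φ _).trans hφ) _).comp
    (contDiff_const.mul (contDiff_apply ℝ ℝ i))

theorem pderiv_gridSum (hs : ContDiff ℝ (⊤ : ℕ∞) φ) (hφ : tsupport φ ⊆ Icc (1 / 4) (3 / 4))
    (σ : (Fin d → Fin n) → ℝ) (β : Fin d → ℕ) (j : Fin d) :
    pderiv j (gridSum n φ σ β) = gridSum n φ σ (β + Pi.single j 1) := by
  have h := pderiv_sum_prod σ
    (fun z i t => (n : ℝ) ^ β i * cellLift (residueInd n (z i)) (deriv^[β i] φ) (n * t))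
    (fun z i t => (n : ℝ) ^ (β i + 1) *
      cellLift (residueInd n (z i)) (deriv^[β i + 1] φ) (n * t))
    (fun z i t => by
      have h1 := hasDerivAt_cellLift ((hs.iterate_deriv (β i)).differentiable (by simp))
        ((tsupport_iterate_deriv_subset φ _).trans hφ) (residueInd n (z i)) (n * t)
      have h2 := (h1.comp t ((hasDerivAt_id t).const_mul (n : ℝ))).const_mul ((n : ℝ) ^ β i)
      rw [Function.iterate_succ_apply']
      refine h2.congr_deriv ?_
      ring) j
  refine h.trans (funext fun x => Finset.sum_congr rfl fun z _ => congrArg _ ?_)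
  refine Finset.prod_congr rfl fun i _ => ?_
  by_cases hij : i = j
  · subst hij
    simp
  · simp [hij]

theorem iterate_pderiv_gridSum (hs : ContDiff ℝ (⊤ : ℕ∞) φ)
    (hφ : tsupport φ ⊆ Icc (1 / 4) (3 / 4)) (σ : (Fin d → Fin n) → ℝ) (β : Fin d → ℕ)
    (j : Fin d) (m : ℕ) :
    (pderiv j)^[m] (gridSum n φ σ β) = gridSum n φ σ (β + Pi.single j m) := by
  induction m with
  | zero => simp
  | succ m ih =>
    rw [Function.iterate_succ_apply', ih, pderiv_gridSum hs hφ, add_assoc, ← Pi.single_add]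

theorem mDeriv_gridSum (hs : ContDiff ℝ (⊤ : ℕ∞) φ) (hφ : tsupport φ ⊆ Icc (1 / 4) (3 / 4))
    (σ : (Fin d → Fin n) → ℝ) (α : Fin d → ℕ) :
    mDeriv α (gridSum n φ σ 0) = gridSum n φ σ α := by
  have key : ∀ l : List (Fin d),
      l.foldr (fun j g => (pderiv j)^[α j] g) (gridSum n φ σ 0) =
        gridSum n φ σ (l.map fun j => Pi.single j (α j)).sum := by
    intro l
    induction l with
    | nil => rfl
    | cons j l ih =>
      rw [List.foldr_cons, ih, iterate_pderiv_gridSum hs hφ, List.map_cons, List.sum_cons,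
        add_comm]
  rw [mDeriv, key, ← List.ofFn_eq_map, List.sum_ofFn, Finset.univ_sum_single]

theorem abs_gridSum_le {σ : (Fin d → Fin n) → ℝ} {a M : ℝ} {N : ℕ} (hσ : ∀ z, |σ z| ≤ a)
    (ha : 0 ≤ a) (hM : ∀ m ≤ N, ∀ t, |deriv^[m] φ t| ≤ M) {β : Fin d → ℕ} (hβ : ∑ j, β j ≤ N)
    (x : Fin d → ℝ) : |gridSum n φ σ β x| ≤ a * M ^ d * (n : ℝ) ^ ∑ j, β j := by
  have hM0 : 0 ≤ M := (abs_nonneg _).trans (hM 0 (Nat.zero_le _) 0)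
  have hβN : ∀ i, β i ≤ N := fun i =>
    (Finset.single_le_sum (fun _ _ => Nat.zero_le _) (Finset.mem_univ i)).trans hβ
  have hind : ∀ (m : Fin n) k, 0 ≤ residueInd n m k := fun m k => by
    unfold residueInd; split_ifs <;> simp
  calc |gridSum n φ σ β x|
      ≤ ∑ z : Fin d → Fin n, a * ∏ i, ((n : ℝ) ^ β i * M * residueInd n (z i) ⌊n * x i⌋) := by
        refine (Finset.abs_sum_le_sum_abs _ _).trans (Finset.sum_le_sum fun z _ => ?_)
        rw [abs_mul, Finset.abs_prod]
        refine mul_le_mul (hσ z) (Finset.prod_le_prod (fun _ _ => abs_nonneg _) fun i _ => ?_)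
          (Finset.prod_nonneg fun _ _ => abs_nonneg _) ha
        rw [cellLift, abs_mul, abs_mul, abs_of_nonneg (hind _ _),
          abs_of_nonneg (pow_nonneg (Nat.cast_nonneg n) _), mul_assoc, mul_comm M]
        have := hM _ (hβN i) (Int.fract (n * x i))
        have := hind (z i) ⌊n * x i⌋
        gcongr
    _ = a * ∏ i, ∑ m : Fin n, ((n : ℝ) ^ β i * M * residueInd n m ⌊n * x i⌋) := by
        rw [← Finset.mul_sum, Finset.prod_univ_sum, Fintype.piFinset_univ]
    _ ≤ a * ∏ i, ((n : ℝ) ^ β i * M) := by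
        refine mul_le_mul_of_nonneg_left (Finset.prod_le_prod (fun i _ => ?_) fun i _ => ?_) ha
        · exact Finset.sum_nonneg fun m _ => mul_nonneg (by positivity) (hind _ _)
        · rw [← Finset.mul_sum]
          exact mul_le_of_le_one_right (by positivity) (sum_residueInd_le_one n _)
    _ = a * M ^ d * (n : ℝ) ^ ∑ j, β j := by
        rw [Finset.prod_mul_distrib, Finset.prod_pow_eq_pow_sum]
        simp only [Finset.prod_const, Finset.card_univ, Fintype.card_fin]
        ring

theorem abs_sub_le_of_pderiv_le {f : (Fin d → ℝ) → ℝ} (hf : Differentiable ℝ f) {C : ℝ}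
    (hC : ∀ j x, |pderiv j f x| ≤ C) (x y : Fin d → ℝ) : |f x - f y| ≤ d * C * ‖x - y‖ := by
  by_cases hd : d = 0
  · subst hd
    simp [Subsingleton.elim x y]
  have hC0 : 0 ≤ C := (abs_nonneg _).trans (hC ⟨0, Nat.pos_of_ne_zero hd⟩ x)
  refine Convex.norm_image_sub_le_of_norm_fderiv_le (𝕜 := ℝ) (s := univ) (fun z _ => hf z)
    (fun z _ => ?_) convex_univ (mem_univ y) (mem_univ x)
  refine ContinuousLinearMap.opNorm_le_bound _ (by positivity) fun v => ?_
  conv_lhs => rw [pi_eq_sum_univ' v]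
  rw [map_sum]
  refine (norm_sum_le _ _).trans ?_
  calc ∑ i, ‖fderiv ℝ f z (v i • Pi.single i 1)‖ ≤ ∑ _i : Fin d, C * ‖v‖ := by
        refine Finset.sum_le_sum fun i _ => ?_
        rw [map_smul, norm_smul, mul_comm]
        exact mul_le_mul (hC i z) (norm_le_pi_norm v i) (norm_nonneg _) hC0
    _ = d * C * ‖v‖ := by simp [mul_assoc]

theorem gridSum_add_single_two (σ : (Fin d → Fin n) → ℝ) (β : Fin d → ℕ) (x : Fin d → ℝ)
    (j : Fin d) : gridSum n φ σ β (x + Pi.single j 2) = gridSum n φ σ β x := by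
  refine Finset.sum_congr rfl fun z _ => congrArg _ (Finset.prod_congr rfl fun i _ =>
    congrArg _ ?_)
  by_cases hij : i = j
  · subst hij
    have : (n : ℝ) * (x + Pi.single i 2 : Fin d → ℝ) i = n * x i + ((2 * n : ℤ) : ℝ) := by
      simp only [Pi.add_apply, Pi.single_eq_same]
      push_cast
      ring
    rw [this, cellLift, cellLift, Int.floor_add_intCast, Int.fract_add_intCast, residueInd,
      residueInd, Int.add_mul_emod_self_right]
  · simp [hij]

theorem gridSum_cell_center (hn : 0 < n) (hφ : φ (1 / 2) = 1) (σ : (Fin d → Fin n) → ℝ)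
    (z : Fin d → Fin n) : gridSum n φ σ 0 (fun i => ((z i : ℝ) + 1 / 2) / n) = σ z := by
  have hn' : (n : ℝ) ≠ 0 := by positivity
  have hfl : ∀ i, ⌊(z i : ℝ) + 1 / 2⌋ = ((z i : ℕ) : ℤ) := fun i =>
    Int.floor_eq_iff.2 ⟨by push_cast; linarith, by push_cast; linarith⟩
  have hterm : ∀ (w : Fin d → Fin n) i, cellLift (residueInd n (w i)) φ (n * (((z i : ℝ) + 1 / 2) / n)) =
      if z i = w i then 1 else 0 := fun w i => by
    have hmod : ((z i : ℕ) : ℤ) % n = ((z i : ℕ) : ℤ) :=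
      Int.emod_eq_of_lt (by positivity) (by exact_mod_cast (z i).2)
    rw [mul_div_cancel₀ _ hn', cellLift, Int.fract, hfl, residueInd, hmod]
    rw [Int.cast_natCast, add_sub_cancel_left, hφ, mul_one]
    simp [Fin.ext_iff]
  simp only [gridSum, Pi.zero_apply, pow_zero, one_mul, Function.iterate_zero, id, hterm]
  rw [Finset.sum_eq_single z]
  · simp
  · intro w _ hw
    obtain ⟨i, hi⟩ := Function.ne_iff.1 hw
    rw [Finset.prod_eq_zero (Finset.mem_univ i) (if_neg hi.symm), mul_zero]
  · simp

end gridSum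

theorem le_mul_rpow_of_le_of_le {u C t s : ℝ} (hC : 0 ≤ C) (ht : 0 ≤ t) (hs0 : 0 ≤ s)
    (hs1 : s ≤ 1) (h1 : u ≤ C) (h2 : u ≤ C * t) : u ≤ C * t ^ s := by
  rcases le_total t 1 with h | h
  · exact h2.trans (mul_le_mul_of_nonneg_left (Real.self_le_rpow_of_le_one ht h hs1) hC)
  · exact h1.trans (le_mul_of_one_le_right hC (Real.one_le_rpow h hs0))

theorem nuStar_lt_and_le {ν : ℝ} (hν : 0 < ν) : (nuStar ν : ℝ) < ν ∧ ν ≤ nuStar ν + 1 := by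
  have h0 : 0 ≤ ⌈ν - 1⌉ := Int.ceil_nonneg_of_neg_one_lt (by linarith)
  have h : (nuStar ν : ℝ) = ⌈ν - 1⌉ := by
    exact_mod_cast Int.toNat_of_nonneg h0
  rw [h]
  constructor <;> linarith [Int.le_ceil (ν - 1), Int.ceil_lt_add_one (ν - 1)]

theorem supBox_le {d : ℕ} {g : (Fin d → ℝ) → ℝ} {C : ℝ} (hC : 0 ≤ C) (h : ∀ x, |g x| ≤ C) :
    supBox g ≤ C :=
  Real.iSup_le (fun x => h x) hC

theorem le_supBox {d : ℕ} {g : (Fin d → ℝ) → ℝ} {C : ℝ} (h : ∀ x, |g x| ≤ C) {x : Fin d → ℝ}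
    (hx : x ∈ box d) : |g x| ≤ supBox g :=
  le_ciSup (f := fun x : box d => |g x|) ⟨C, by rintro _ ⟨y, rfl⟩; exact h y⟩ ⟨x, hx⟩

theorem holderCondD_gridSum {d n : ℕ} (hd : 1 ≤ d) (hn : 0 < n) {ν : ℝ} (hν : 0 < ν) {φ : ℝ → ℝ}
    (hs : ContDiff ℝ (⊤ : ℕ∞) φ) (hφ : tsupport φ ⊆ Icc (1 / 4) (3 / 4)) {M a : ℝ}
    (hM : ∀ m ≤ nuStar ν + 1, ∀ t, |deriv^[m] φ t| ≤ M) {σ : (Fin d → Fin n) → ℝ}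
    (ha : 0 ≤ a) (hσ : ∀ z, |σ z| ≤ a) (haM : 2 * d * M ^ d * a * (n : ℝ) ^ ν ≤ 1) :
    HolderCondD ν (gridSum n φ σ 0) 1 := by
  have hM0 : 0 ≤ M := (abs_nonneg _).trans (hM 0 (Nat.zero_le _) 0)
  have hn' : (0 : ℝ) < n := by exact_mod_cast hn
  have hd' : (1 : ℝ) ≤ d := by exact_mod_cast hd
  obtain ⟨hν1, hν2⟩ := nuStar_lt_and_le hν
  intro α hα x y
  rw [mDeriv_gridSum hs hφ]
  have hb : ∀ x, |gridSum n φ σ α x| ≤ a * M ^ d * (n : ℝ) ^ nuStar ν := fun x => by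
    have := abs_gridSum_le hσ ha hM (β := α) (by omega) x
    rwa [hα] at this
  have hLip := abs_sub_le_of_pderiv_le ((contDiff_gridSum hs hφ σ α).differentiable (by simp))
    (C := a * M ^ d * (n : ℝ) ^ (nuStar ν + 1)) (fun j x => by
      have hsum : ∑ i, (α + Pi.single j 1 : Fin d → ℕ) i = nuStar ν + 1 := by
        simp [Finset.sum_add_distrib, hα]
      have := abs_gridSum_le hσ ha hM hsum.le x
      rwa [hsum, ← pderiv_gridSum hs hφ] at this) x y
  set B := a * M ^ d * (n : ℝ) ^ nuStar ν with hB
  have hB0 : 0 ≤ B := by positivity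
  have key := le_mul_rpow_of_le_of_le (u := |gridSum n φ σ α x - gridSum n φ σ α y|)
    (C := 2 * d * B) (t := n * ‖x - y‖) (s := ν - nuStar ν) (by positivity) (by positivity)
    (by linarith) (by linarith)
    (by nlinarith [abs_sub (gridSum n φ σ α x) (gridSum n φ σ α y), hb x, hb y])
    (hLip.trans (by
      have : 0 ≤ d * B * (n * ‖x - y‖) := by positivity
      calc d * (a * M ^ d * (n : ℝ) ^ (nuStar ν + 1)) * ‖x - y‖
          = d * B * (n * ‖x - y‖) := by rw [hB]; ring
        _ ≤ 2 * d * B * (n * ‖x - y‖) := by linarith))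
  refine key.trans ?_
  rw [Real.mul_rpow hn'.le (norm_nonneg _), ← mul_assoc]
  refine mul_le_mul_of_nonneg_right (le_of_eq_of_le ?_ haM) (by positivity)
  rw [Real.rpow_sub hn', Real.rpow_natCast, hB]
  field_simp

theorem cnuNormD_gridSum_le_one {d n : ℕ} (hd : 1 ≤ d) (hn : 0 < n) {ν : ℝ} (hν : 0 < ν)
    {φ : ℝ → ℝ} (hs : ContDiff ℝ (⊤ : ℕ∞) φ) (hφ : tsupport φ ⊆ Icc (1 / 4) (3 / 4)) {M a : ℝ}
    (hM : ∀ m ≤ nuStar ν + 1, ∀ t, |deriv^[m] φ t| ≤ M) {σ : (Fin d → Fin n) → ℝ}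
    (ha : 0 ≤ a) (hσ : ∀ z, |σ z| ≤ a) (haM : 2 * d * M ^ d * a * (n : ℝ) ^ ν ≤ 1) :
    CnuNormD ν (gridSum n φ σ 0) ≤ 1 := by
  have hM0 : 0 ≤ M := (abs_nonneg _).trans (hM 0 (Nat.zero_le _) 0)
  have hn' : (1 : ℝ) ≤ n := by exact_mod_cast hn
  have hd' : (1 : ℝ) ≤ d := by exact_mod_cast hd
  refine max_le (Real.sSup_le ?_ zero_le_one) (csInf_le ⟨0, fun L hL => hL.1⟩
    ⟨zero_le_one, holderCondD_gridSum hd hn hν hs hφ hM ha hσ haM⟩)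
  rintro _ ⟨α, hα, rfl⟩
  rw [mDeriv_gridSum hs hφ]
  refine supBox_le zero_le_one fun x => (abs_gridSum_le hσ ha hM (by omega) x).trans ?_
  refine le_trans ?_ haM
  have h1 : (n : ℝ) ^ ∑ j, α j ≤ (n : ℝ) ^ ν := by
    rw [← Real.rpow_natCast]
    refine Real.rpow_le_rpow_of_exponent_le hn' (le_trans ?_ (nuStar_lt_and_le hν).1.le)
    exact_mod_cast hα
  calc a * M ^ d * (n : ℝ) ^ ∑ j, α j ≤ a * M ^ d * (n : ℝ) ^ ν := by gcongr
    _ ≤ 2 * d * (a * M ^ d * (n : ℝ) ^ ν) := le_mul_of_one_le_left (by positivity) (by linarith)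
    _ = 2 * d * M ^ d * a * (n : ℝ) ^ ν := by ring

theorem exists_bump_on_unit_cell : ∃ φ : ℝ → ℝ, ContDiff ℝ (⊤ : ℕ∞) φ ∧
    tsupport φ ⊆ Icc (1 / 4) (3 / 4) ∧ HasCompactSupport φ ∧ φ (1 / 2) = 1 := by
  let b : ContDiffBump (1 / 2 : ℝ) := ⟨1 / 8, 1 / 4, by norm_num, by norm_num⟩
  refine ⟨b, b.contDiff, ?_, b.hasCompactSupport, b.one_of_mem_closedBall (by simp [b])⟩
  rw [b.tsupport_eq, Real.closedBall_eq_Icc]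
  norm_num [b]

/-- For every `d ≥ 1` and `ν > 0` there are `c > 0` and `ε₀ > 0` such that
for every `ε ∈ (0, ε₀)` there exist `J ≥ 2^{c ε^{-d/ν}}` functions in `C_p^ν([-1,1]^d)` with
`C^ν` norm at most `1` that are pairwise `ε`-separated in sup norm on `[-1,1]^d`. -/
theorem packing_smooth_periodic (d : ℕ) (hd : 1 ≤ d) (ν : ℝ) (hν : 0 < ν) :
    ∃ c ε₀ : ℝ, 0 < c ∧ 0 < ε₀ ∧
      ∀ ε : ℝ, 0 < ε → ε < ε₀ →
        ∃ (J : ℕ) (f : Fin J → ((Fin d → ℝ) → ℝ)),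
          (2 : ℝ) ^ (c * ε ^ (-(d : ℝ) / ν)) ≤ (J : ℝ) ∧
          (∀ j : Fin J, MemCpD ν (f j) ∧ CnuNormD ν (f j) ≤ 1) ∧
          (∀ j j' : Fin J, j ≠ j' → ε ≤ supBox (fun x => f j x - f j' x)) := by
  obtain ⟨φ, hs, hφ, hc, hφ1⟩ := exists_bump_on_unit_cell
  obtain ⟨M, hM1, hM⟩ := exists_iterate_deriv_bound hs hc (nuStar ν + 1)
  have hd' : (1 : ℝ) ≤ d := by exact_mod_cast hd
  set A : ℝ := (2 * d * M ^ d)⁻¹ with hA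
  have hA0 : 0 < A := by positivity
  refine ⟨(A ^ (1 / ν) / 2) ^ d, A, by positivity, hA0, fun ε hε hεA => ?_⟩
  set T : ℝ := (A / ε) ^ (1 / ν) with hT
  have hT1 : 1 ≤ T := Real.one_le_rpow ((one_le_div hε).2 hεA.le) (by positivity)
  set n : ℕ := ⌊T⌋₊ with hn
  have hn0 : 0 < n := Nat.floor_pos.2 hT1
  have hn' : (1 : ℝ) ≤ n := by exact_mod_cast hn0
  have hnT : (n : ℝ) ≤ T := Nat.floor_le (by linarith)
  have hTn : T / 2 ≤ n := by linarith [Nat.lt_floor_add_one T]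
  set a : ℝ := A / (n : ℝ) ^ ν with ha
  have hnν : 0 < (n : ℝ) ^ ν := by positivity
  have ha0 : 0 < a := by positivity
  have haε : ε ≤ a := by
    rw [ha, le_div_iff₀ hnν, mul_comm, ← le_div_iff₀ hε]
    calc (n : ℝ) ^ ν ≤ T ^ ν := Real.rpow_le_rpow (by positivity) hnT hν.le
      _ = A / ε := by
        rw [hT, ← Real.rpow_mul (by positivity), one_div_mul_cancel hν.ne', Real.rpow_one]
  have haM : 2 * d * M ^ d * a * (n : ℝ) ^ ν ≤ 1 := by
    rw [ha, hA]
    field_simp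
    rfl
  let σ : ((Fin d → Fin n) → Bool) → (Fin d → Fin n) → ℝ := fun s z => if s z then a else 0
  have hσ : ∀ s z, |σ s z| ≤ a := fun s z => by
    by_cases h : s z <;> simp [σ, h, abs_of_pos ha0, ha0.le]
  let e := Fintype.equivFin ((Fin d → Fin n) → Bool)
  refine ⟨_, fun j => gridSum n φ (σ (e.symm j)) 0, ?_, fun j => ⟨⟨?_, ?_, 1, zero_le_one, ?_⟩, ?_⟩,
    fun j j' hj => ?_⟩
  · have hcard : (Fintype.card ((Fin d → Fin n) → Bool) : ℝ) = 2 ^ ((n : ℝ) ^ d) := by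
      rw [← Nat.cast_pow, Real.rpow_natCast]
      simp
    rw [hcard]
    refine Real.rpow_le_rpow_of_exponent_le one_le_two ?_
    calc (A ^ (1 / ν) / 2) ^ d * ε ^ (-(d : ℝ) / ν) = (T / 2) ^ d := by
          have : ε ^ (-(d : ℝ) / ν) = ((ε ^ (1 / ν))⁻¹) ^ d := by
            rw [← Real.rpow_neg hε.le, ← Real.rpow_natCast, ← Real.rpow_mul hε.le]
            congr 1
            ring
          rw [this, ← mul_pow, hT, Real.div_rpow hA0.le hε.le]
          congr 1
          ring
      _ ≤ (n : ℝ) ^ d := pow_le_pow_left₀ (by positivity) hTn d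
  · exact fun x i => gridSum_add_single_two _ _ x i
  · exact (contDiff_gridSum hs hφ _ _).of_le (by exact_mod_cast le_top)
  · exact holderCondD_gridSum hd hn0 hν hs hφ hM ha0.le (hσ _) haM
  · exact cnuNormD_gridSum_le_one hd hn0 hν hs hφ hM ha0.le (hσ _) haM
  · obtain ⟨z, hz⟩ := Function.ne_iff.1 (e.symm.injective.ne hj)
    have hbd : ∀ s x, |gridSum n φ (σ s) 0 x| ≤
        a * M ^ d * (n : ℝ) ^ ∑ j : Fin d, (0 : Fin d → ℕ) j :=
      fun s x => abs_gridSum_le (hσ s) ha0.le hM (by simp) x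
    have hbox : (fun i => ((z i : ℝ) + 1 / 2) / n) ∈ box d := by
      refine fun i _ => ⟨le_trans (by norm_num) (show (0 : ℝ) ≤ _ by positivity), ?_⟩
      have : (z i : ℝ) + 1 ≤ n := by exact_mod_cast (z i).2
      rw [div_le_one (by linarith)]
      linarith
    refine le_trans (haε.trans ?_) (le_supBox
      (fun x => (abs_sub _ _).trans (add_le_add (hbd _ x) (hbd _ x))) hbox)
    rw [gridSum_cell_center hn0 hφ1, gridSum_cell_center hn0 hφ1]
    cases h1 : e.symm j z <;> cases h2 : e.symm j' z <;> simp_all [σ, abs_of_pos]
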